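/- arXiv:2006.12180 — 2 statements merged into one kernel-verified Lean document; each statement's English description precedes it below -/
import Mathlib

section
/- Let d ≥ 1 be an integer, μ ∈ ℝ^d, Σ a symmetric positive definite real d×d matrix, and θ ∈ (0,1). Then for every x ∈ ℝ^d with x ≠ μ, the MTIN density is a uniform scale mixture of normal densities: f_TIN(x; μ, Σ, θ) = (1/θ) · ∫_{1−θ}^{1} (2π)^(−d/2) · w^(d/2) · |Σ|^(−1/2) · exp(−w·δ(x)/2) dw, where the integrand is the density of N_d(μ, Σ/w). -/
open MeasureTheory Real Filter Set Matrix intervalIntegral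

/-- Upper incomplete gamma function `Γ(s, x) = ∫ₓ^∞ t^(s-1) e^(-t) dt`. -/
noncomputable def uGamma (s x : ℝ) : ℝ := ∫ t in Set.Ioi x, t ^ (s - 1) * Real.exp (-t)

/-- Squared Mahalanobis distance `δ(x) = (x-μ)ᵀ Σ⁻¹ (x-μ)`. -/
noncomputable def mahal {d : ℕ} (μ : Fin d → ℝ) (S : Matrix (Fin d) (Fin d) ℝ)
    (x : Fin d → ℝ) : ℝ :=
  (x - μ) ⬝ᵥ (S⁻¹ *ᵥ (x - μ))

/-- The multivariate tail-inflated normal (MTIN) density. -/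
noncomputable def mtin (d : ℕ) (μ : Fin d → ℝ) (S : Matrix (Fin d) (Fin d) ℝ) (θ : ℝ)
    (x : Fin d → ℝ) : ℝ :=
  2 * Real.pi ^ (-(d : ℝ) / 2) * S.det ^ (-(1 : ℝ) / 2) /
      (θ * mahal μ S x ^ ((d : ℝ) / 2 + 1)) *
    (uGamma ((d : ℝ) / 2 + 1) ((1 - θ) * mahal μ S x / 2) -
      uGamma ((d : ℝ) / 2 + 1) (mahal μ S x / 2))

theorem mahal_pos {d : ℕ} {μ x : Fin d → ℝ} {S : Matrix (Fin d) (Fin d) ℝ}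
    (hS : S.PosDef) (hx : x ≠ μ) : 0 < mahal μ S x := by
  simpa [mahal] using hS.inv.dotProduct_mulVec_pos (sub_ne_zero.mpr hx)

theorem uGamma_sub_uGamma {s a b : ℝ} (hs : 0 < s) (ha : 0 ≤ a) (hab : a ≤ b) :
    uGamma s a - uGamma s b = ∫ t in a..b, t ^ (s - 1) * Real.exp (-t) := by
  have hint : IntegrableOn (fun t : ℝ => t ^ (s - 1) * Real.exp (-t)) (Set.Ioi 0) := by
    simpa only [mul_comm] using Real.GammaIntegral_convergent hs
  exact intervalIntegral.integral_Ioi_sub_Ioi (hint.mono_set (Set.Ioi_subset_Ioi ha)) hab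

/-- Rescaling `t = w * c` in a truncated gamma integral. -/
theorem integral_rpow_mul_exp_neg_mul {p a b c : ℝ} (hc : 0 < c) (ha : 0 ≤ a) (hab : a ≤ b) :
    ∫ w in a..b, w ^ p * Real.exp (-(w * c)) =
      (c ^ (p + 1))⁻¹ * ∫ t in (a * c)..(b * c), t ^ p * Real.exp (-t) := by
  have hsub := intervalIntegral.integral_comp_mul_right (a := a) (b := b)
    (fun t : ℝ => t ^ p * Real.exp (-t)) hc.ne'
  have hcongr : ∫ w in a..b, (w * c) ^ p * Real.exp (-(w * c)) =
      c ^ p * ∫ w in a..b, w ^ p * Real.exp (-(w * c)) := by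
    rw [← intervalIntegral.integral_const_mul]
    refine intervalIntegral.integral_congr fun w hw => ?_
    rw [Set.uIcc_of_le hab] at hw
    simp only [Real.mul_rpow (ha.trans hw.1) hc.le]
    ring
  have hcp : 0 < c ^ p := Real.rpow_pos_of_pos hc p
  rw [hcongr, smul_eq_mul] at hsub
  rw [Real.rpow_add_one hc.ne', mul_inv, mul_assoc, ← hsub, inv_mul_cancel_left₀ hcp.ne']

/-- The MTIN density is a uniform scale mixture of multivariate normal densities. -/
theorem mtin_eq_scale_mixture (d : ℕ) (hd : 1 ≤ d) (μ : Fin d → ℝ)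
    (S : Matrix (Fin d) (Fin d) ℝ) (hS : S.PosDef) (θ : ℝ) (hθ : θ ∈ Set.Ioo (0 : ℝ) 1)
    (x : Fin d → ℝ) (hx : x ≠ μ) :
    mtin d μ S θ x = (1 / θ) * ∫ w in (1 - θ)..1,
      (2 * Real.pi) ^ (-(d : ℝ) / 2) * w ^ ((d : ℝ) / 2) * S.det ^ (-(1 : ℝ) / 2) *
        Real.exp (-(w * mahal μ S x) / 2) := by
  obtain ⟨hθ0, hθ1⟩ := hθ
  have hδ := mahal_pos hS hx
  rw [mtin]
  generalize mahal μ S x = δ at hδ ⊢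
  generalize S.det ^ (-(1 : ℝ) / 2) = D
  have hp : 0 ≤ (d : ℝ) / 2 := by positivity
  have hneg : -(d : ℝ) / 2 = -((d : ℝ) / 2) := neg_div _ _
  rw [hneg]
  generalize (d : ℝ) / 2 = p at hp ⊢
  have hmix : ∫ w in (1 - θ)..1,
      (2 * Real.pi) ^ (-p) * w ^ p * D * Real.exp (-(w * δ) / 2) =
      (2 * Real.pi) ^ (-p) * D * ∫ w in (1 - θ)..1, w ^ p * Real.exp (-(w * (δ / 2))) := by
    rw [← intervalIntegral.integral_const_mul]
    congr 1 with w
    rw [neg_div, mul_div_assoc w δ 2]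
    ring
  have hconst : (2 * Real.pi) ^ (-p) * ((δ / 2) ^ (p + 1))⁻¹ =
      2 * Real.pi ^ (-p) / δ ^ (p + 1) := by
    rw [Real.mul_rpow zero_le_two Real.pi_pos.le, Real.div_rpow hδ.le zero_le_two,
      Real.rpow_add_one two_ne_zero, Real.rpow_neg zero_le_two]
    have h2 : 0 < (2 : ℝ) ^ p := Real.rpow_pos_of_pos two_pos p
    field_simp
  rw [uGamma_sub_uGamma (by linarith) (by nlinarith) (by nlinarith), hmix,
    integral_rpow_mul_exp_neg_mul (half_pos hδ) (by linarith) (by linarith),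
    add_sub_cancel_right, mul_div_assoc (1 - θ) δ 2, one_mul]
  generalize ∫ t in ((1 - θ) * (δ / 2))..(δ / 2), t ^ p * Real.exp (-t) = I
  calc _ = 1 / θ * (2 * Real.pi ^ (-p) / δ ^ (p + 1)) * D * I := by
        field_simp
    _ = _ := by
        rw [← hconst]
        ring
end

section
/- Let d ≥ 1 be an integer and θ ∈ (0,1), and define g(t) = (2 π^(−d/2)/θ) · t^(−(d/2+1)) · [Γ(d/2+1, (1−θ)t/2) − Γ(d/2+1, t/2)] for t > 0. Then for every t > 0, g is differentiable at t with derivative g′(t) = −(2 π^(−d/2)/θ) · t^(−(d/2+2)) · [Γ(d/2+2, (1−θ)t/2) − Γ(d/2+2, t/2)]. -/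
open MeasureTheory Real Filter Set

lemma integrableOn_rpow_mul_exp_neg {s x : ℝ} (hs : 0 < s) (hx : 0 ≤ x) :
    IntegrableOn (fun u : ℝ => u ^ (s - 1) * Real.exp (-u)) (Set.Ioi x) := by
  simpa only [mul_comm] using
    (Real.GammaIntegral_convergent hs).mono_set (Set.Ioi_subset_Ioi hx)

lemma hasDerivAt_uGamma {s x : ℝ} (hs : 0 < s) (hx : 0 < x) :
    HasDerivAt (uGamma s) (-(x ^ (s - 1) * Real.exp (-x))) x := by
  have hint : ∀ y, 0 < y → uGamma s y =
      uGamma s x - ∫ u in x..y, u ^ (s - 1) * Real.exp (-u) := by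
    intro y hy
    rw [← intervalIntegral.integral_Ioi_sub_Ioi' (integrableOn_rpow_mul_exp_neg hs hx.le)
      (integrableOn_rpow_mul_exp_neg hs hy.le), uGamma, uGamma]
    ring
  have hcont : ContinuousOn (fun u : ℝ => u ^ (s - 1) * Real.exp (-u)) (Set.Ioi 0) :=
    (continuousOn_id.rpow_const fun u hu => Or.inl (ne_of_gt hu)).mul (by fun_prop)
  have hderiv : HasDerivAt (fun y => ∫ u in x..y, u ^ (s - 1) * Real.exp (-u))
      (x ^ (s - 1) * Real.exp (-x)) x :=
    intervalIntegral.integral_hasDerivAt_right (by simp)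
      (hcont.stronglyMeasurableAtFilter isOpen_Ioi x hx)
      (hcont.continuousAt (Ioi_mem_nhds hx))
  exact (hderiv.const_sub (uGamma s x)).congr_of_eventuallyEq
    ((eventually_gt_nhds hx).mono hint)

/-- The recurrence `Γ(s + 1, x) = s Γ(s, x) + x ^ s e ^ (-x)`. -/
lemma uGamma_add_one {s x : ℝ} (hs : 0 < s) (hx : 0 ≤ x) :
    uGamma (s + 1) x = s * uGamma s x + x ^ s * Real.exp (-x) := by
  have hi := integrableOn_rpow_mul_exp_neg hs hx
  have hi' : IntegrableOn (fun u : ℝ => u ^ s * Real.exp (-u)) (Set.Ioi x) := by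
    simpa using integrableOn_rpow_mul_exp_neg (by linarith : 0 < s + 1) hx
  have hderiv : ∀ u ∈ Set.Ioi x, HasDerivAt (fun u : ℝ => u ^ s * Real.exp (-u))
      (s * (u ^ (s - 1) * Real.exp (-u)) - u ^ s * Real.exp (-u)) u := by
    intro u hu
    have hu0 : u ≠ 0 := (hx.trans_lt hu).ne'
    convert! (Real.hasDerivAt_rpow_const (p := s) (Or.inl hu0)).mul (hasDerivAt_neg u).exp using 1
    ring
  have hlim : Tendsto (fun u : ℝ => u ^ s * Real.exp (-u)) atTop (nhds 0) := by
    simpa using tendsto_rpow_mul_exp_neg_mul_atTop_nhds_zero s 1 one_pos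
  have hcont : ContinuousWithinAt (fun u : ℝ => u ^ s * Real.exp (-u)) (Set.Ici x) x :=
    ((Real.continuousAt_rpow_const x s (Or.inr hs.le)).mul (by fun_prop)).continuousWithinAt
  have key := integral_Ioi_of_hasDerivAt_of_tendsto hcont hderiv ((hi.const_mul s).sub hi') hlim
  rw [integral_sub (hi.const_mul s) hi', integral_const_mul] at key
  simp only [uGamma, add_sub_cancel_right]
  linarith

lemma hasDerivAt_rpow_neg_mul_uGamma {s c t : ℝ} (hs : 0 < s) (hc : 0 < c) (ht : 0 < t) :
    HasDerivAt (fun t : ℝ => t ^ (-s) * uGamma s (c * t))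
      (-(t ^ (-(s + 1)) * uGamma (s + 1) (c * t))) t := by
  have hct : 0 < c * t := mul_pos hc ht
  have hG : HasDerivAt (fun t => uGamma s (c * t))
      (-((c * t) ^ (s - 1) * Real.exp (-(c * t))) * c) t :=
    (hasDerivAt_uGamma hs hct).comp t (by simpa using (hasDerivAt_id t).const_mul c)
  convert! (Real.hasDerivAt_rpow_const (p := -s) (Or.inl ht.ne')).mul hG using 1
  rw [uGamma_add_one hs hct.le, Real.rpow_sub_one hct.ne', neg_add', Real.rpow_sub_one ht.ne']
  field_simp
  ring

/-- The density generator `g` of the MTIN distribution is differentiable on (0,∞), with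
derivative `g′(t) = −(2π^(−d/2)/θ)·t^(−(d/2+2))·[Γ(d/2+2,(1−θ)t/2) − Γ(d/2+2,t/2)]`. -/
theorem mtin_generator_hasDerivAt (d : ℕ) (hd : 1 ≤ d) (θ : ℝ)
    (hθ : θ ∈ Set.Ioo (0 : ℝ) 1) (t : ℝ) (ht : 0 < t) :
    HasDerivAt
      (fun t : ℝ => (2 * Real.pi ^ (-(d : ℝ) / 2) / θ) * t ^ (-((d : ℝ) / 2 + 1)) *
        (uGamma ((d : ℝ) / 2 + 1) ((1 - θ) * t / 2) - uGamma ((d : ℝ) / 2 + 1) (t / 2)))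
      (-(2 * Real.pi ^ (-(d : ℝ) / 2) / θ) * t ^ (-((d : ℝ) / 2 + 2)) *
        (uGamma ((d : ℝ) / 2 + 2) ((1 - θ) * t / 2) - uGamma ((d : ℝ) / 2 + 2) (t / 2)))
      t := by
  have hs : (0 : ℝ) < (d : ℝ) / 2 + 1 := by positivity
  have hc : 0 < (1 - θ) / 2 := by linarith [hθ.2]
  have h := ((hasDerivAt_rpow_neg_mul_uGamma hs hc ht).sub
    (hasDerivAt_rpow_neg_mul_uGamma hs one_half_pos ht)).const_mul
      (2 * Real.pi ^ (-(d : ℝ) / 2) / θ)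
  have e₁ (u : ℝ) : (1 - θ) / 2 * u = (1 - θ) * u / 2 := by ring
  have e₂ (u : ℝ) : 1 / 2 * u = u / 2 := by ring
  have e₃ : (d : ℝ) / 2 + 1 + 1 = (d : ℝ) / 2 + 2 := by ring
  simp only [e₁, e₂, e₃] at h
  convert! h using 1
  · funext u
    simp only [Pi.sub_apply]
    ring
  · ring
end
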